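/- For every i ≥ 0, if v_i = 0 then v_{2i} = 0, and if v_i = 2 then v_{2i} = 2. -/

import Mathlib

/-- The morphism μ : 0 ↦ 012, 1 ↦ 02, 2 ↦ 1. -/
def mu : Fin 3 → List (Fin 3)
  | 0 => [0, 1, 2]
  | 1 => [0, 2]
  | 2 => [1]

/-- Apply μ to a finite word. -/
def muWord (l : List (Fin 3)) : List (Fin 3) := l.flatMap mu

/-- The word vtm = 012021012102012⋯, the fixed point of μ starting with 0,
obtained as the limit of μ^n(0): since μ^m(0) is a prefix of μ^(m+1)(0) and
its length exceeds n for m = n+1, the n-th letter is read off from μ^(n+1)(0). -/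
def vtm (n : ℕ) : Fin 3 := ((muWord^[n + 1]) [0]).getD n 0
/-- Thue–Morse sequence. -/
def tmo (n : ℕ) : Bool := if h : n = 0 then false else xor (tmo (n / 2)) (n % 2 == 1)
termination_by n
decreasing_by omega

theorem tmo_zero : tmo 0 = false := by rw [tmo]; simp

theorem tmo_even (n : ℕ) : tmo (2 * n) = tmo n := by
  rcases Nat.eq_zero_or_pos n with h | h
  · subst h; rfl
  · rw [tmo, dif_neg (by omega)]
    have h1 : 2 * n / 2 = n := by omega
    have h2 : 2 * n % 2 = 0 := by omega
    rw [h1, h2]; simp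

theorem tmo_odd (n : ℕ) : tmo (2 * n + 1) = !tmo n := by
  rw [tmo, dif_neg (by omega)]
  have h1 : (2 * n + 1) / 2 = n := by omega
  have h2 : (2 * n + 1) % 2 = 1 := by omega
  rw [h1, h2]; simp

/-- Coding of a pair of consecutive Thue–Morse letters. -/
def dcode : Bool → Bool → Fin 3
  | false, true => 0
  | true, false => 2
  | _, _ => 1

/-- Coded differences of Thue–Morse. -/
def dseq (n : ℕ) : Fin 3 := dcode (tmo n) (tmo (n + 1))

/-- Prefixes of the difference sequence. -/
def wpre (n : ℕ) : List (Fin 3) := (List.range n).map dseq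

theorem wpre_succ (n : ℕ) : wpre (n + 1) = wpre n ++ [dseq n] := by
  simp [wpre, List.range_succ]

theorem dseq_even (n : ℕ) : dseq (2 * n) = dcode (tmo n) (!tmo n) := by
  rw [dseq, tmo_even, tmo_odd]

theorem dseq_odd (n : ℕ) : dseq (2 * n + 1) = dcode (!tmo n) (tmo (n + 1)) := by
  rw [dseq, tmo_odd, show 2 * n + 1 + 1 = 2 * (n + 1) by ring, tmo_even]

theorem dseq_even' (n : ℕ) : dseq (2 * n + 2) = dcode (tmo (n + 1)) (!tmo (n + 1)) :=
  dseq_even (n + 1)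

theorem muWord_wpre (n : ℕ) : muWord (wpre n) = wpre (2 * n + (tmo n).toNat) := by
  induction n with
  | zero => simp [wpre, muWord, tmo_zero]
  | succ n ih =>
    have h : muWord (wpre (n + 1)) = muWord (wpre n) ++ mu (dseq n) := by
      rw [wpre_succ]; simp [muWord]
    rw [h, ih, dseq]
    have e0 := dseq_even n
    have e1 := dseq_odd n
    have e2 := dseq_even' n
    have s0 := wpre_succ (2 * n)
    have s1 := wpre_succ (2 * n + 1)
    have s2 := wpre_succ (2 * n + 2)
    rw [show 2 * (n + 1) = 2 * n + 2 by ring]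
    generalize tmo n = a at *
    generalize tmo (n + 1) = b at *
    cases a <;> cases b <;> simp_all [dcode, mu]

theorem iter_wpre (k : ℕ) : ∃ L, k < L ∧ muWord^[k] [0] = wpre L := by
  induction k with
  | zero =>
    refine ⟨1, by omega, ?_⟩
    have := dseq_even 0
    simp [tmo_zero, dcode] at this
    simp [wpre, this]
  | succ k ih =>
    obtain ⟨L, hL, h⟩ := ih
    refine ⟨2 * L + (tmo L).toNat, by omega, ?_⟩
    rw [Function.iterate_succ_apply', h, muWord_wpre]

theorem vtm_eq (n : ℕ) : vtm n = dseq n := by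
  obtain ⟨L, hL, h⟩ := iter_wpre (n + 1)
  have hn : n < L := by omega
  rw [vtm, h]
  simp [wpre, List.getD, hn]

/-- If v_i = 0 then v_{2i} = 0, and if v_i = 2 then v_{2i} = 2. -/
theorem vtm_double (i : ℕ) :
    (vtm i = 0 → vtm (2 * i) = 0) ∧ (vtm i = 2 → vtm (2 * i) = 2) := by
  rw [vtm_eq, vtm_eq, dseq_even, dseq]
  generalize tmo i = a
  generalize tmo (i + 1) = b
  cases a <;> cases b <;> simp [dcode]
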